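/- Let y ∈ ℝⁿ and r ∈ R_n. Then y ∈ Bad(r) if and only if there exist κ ∈ (0,1) and b > 1 such that for all t ∈ ℕ one has δ(g^t_{r,b} G(κ; y) ℤ^{n+1}) ≥ 1. -/

import Mathlib

open ENNReal

/-- Distance from a real number to the nearest integer. -/
noncomputable def distNearestInt (x : ℝ) : ℝ := ⨅ p : ℤ, |x - (p : ℝ)|

/-- `badPow ρ x = x ^ (1/ρ)`, with the convention `x ^ (1/0) = 0`. -/
noncomputable def badPow (ρ x : ℝ) : ℝ := if ρ = 0 then 0 else x ^ (1 / ρ)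

/-- The set `R_n` of weight vectors: nonnegative components summing to `1`. -/
def Weights (n : ℕ) : Set (Fin n → ℝ) := {r | (∑ i, r i) = 1 ∧ ∀ i, 0 ≤ r i}

/-- The set `Bad(r)` of `r`-badly approximable points of `ℝⁿ`. -/
def BadSet {n : ℕ} (r : Fin n → ℝ) : Set (Fin n → ℝ) :=
  {y | ∃ c > 0, ∀ q : ℕ, 1 ≤ q →
    ∃ i, c * (q : ℝ)⁻¹ ≤ badPow (r i) (distNearestInt (q * y i))}

/-- `δ(Λ) = inf {‖a‖_∞ : a ∈ Λ, a ≠ 0}` (valued in `ℝ≥0∞`, so `δ({0}) = ∞`);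
the norm on `Fin d → ℝ` is the sup norm. -/
noncomputable def latDelta {d : ℕ} (Λ : Set (Fin d → ℝ)) : ℝ≥0∞ :=
  ⨅ a ∈ (Λ \ {0}), (‖a‖₊ : ℝ≥0∞)

/-- The matrix `G(κ; y)`: first row `(κ⁻¹, κ⁻¹ y)`, remaining rows `(0, Iₙ)`. -/
noncomputable def Gmat {n : ℕ} (κ : ℝ) (y : Fin n → ℝ) :
    Matrix (Fin (n + 1)) (Fin (n + 1)) ℝ :=
  Matrix.of fun i j =>
    Fin.cases (Fin.cases κ⁻¹ (fun j' => κ⁻¹ * y j') j)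
      (fun i' => if j = i'.succ then (1 : ℝ) else 0) i

/-- The diagonal matrix `g^s_{r,b} = diag(b^s, b^{-r₁ s}, …, b^{-rₙ s})`. -/
noncomputable def gmat {n : ℕ} (r : Fin n → ℝ) (b : ℝ) (s : ℝ) :
    Matrix (Fin (n + 1)) (Fin (n + 1)) ℝ :=
  Matrix.diagonal (Fin.cases (b ^ s) fun i => b ^ (-(r i) * s))

/-- The image of a subset of `ℝ^d` under (multiplication by) a matrix. -/
def latImage {d : ℕ} (A : Matrix (Fin d) (Fin d) ℝ) (Λ : Set (Fin d → ℝ)) :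
    Set (Fin d → ℝ) := (fun v => A.mulVec v) '' Λ

/-- The integer lattice `ℤ^d` inside `ℝ^d`. -/
def intLattice (d : ℕ) : Set (Fin d → ℝ) := {x | ∀ i, ∃ m : ℤ, x i = (m : ℝ)}


theorem dni_le (x : ℝ) (p : ℤ) : distNearestInt x ≤ |x - p| :=
  ciInf_le (f := fun p : ℤ => |x - (p : ℝ)|) ⟨0, by rintro _ ⟨p, rfl⟩; exact abs_nonneg _⟩ p

theorem dni_round (x : ℝ) : |x - round x| ≤ distNearestInt x :=
  le_ciInf fun p => round_le x p

theorem dni_nonneg (x : ℝ) : 0 ≤ distNearestInt x :=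
  (abs_nonneg _).trans (dni_round x)

theorem pigeon_one {n : ℕ} (q : ℕ) (hq : 1 ≤ q) (p : Fin n → ℤ) (A : Fin n → ℝ)
    (hA : ∀ i, 0 < A i) (h : (q : ℝ) < ∏ i, A i) :
    ∃ (a0 : ℤ) (a : Fin n → ℤ), a ≠ 0 ∧ (∀ i, |(a i : ℝ)| < A i) ∧
      a0 * q + ∑ i, a i * p i = 0 := by
  have hq' : (0 : ℤ) < q := by exact_mod_cast hq
  obtain ⟨v, hv, w, hw, hne, he⟩ := Finset.exists_ne_map_eq_of_card_lt_of_maps_to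
    (s := Fintype.piFinset fun i => Finset.Ico (0 : ℤ) ⌈A i⌉) (t := Finset.Ico (0 : ℤ) q)
    (f := fun v => (∑ i, v i * p i) % (q : ℤ))
    (by
      rw [Fintype.card_piFinset]
      simp only [Int.card_Ico, sub_zero, Int.toNat_natCast]
      have : (q : ℝ) < ((∏ i, ⌈A i⌉.toNat : ℕ) : ℝ) := by
        refine h.trans_le ?_
        push_cast
        refine Finset.prod_le_prod (fun i _ => (hA i).le) fun i _ => ?_
        have h1 : A i ≤ ⌈A i⌉ := Int.le_ceil _
        have h2 : (⌈A i⌉ : ℝ) ≤ ((⌈A i⌉.toNat : ℤ) : ℝ) := by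
          exact_mod_cast Int.self_le_toNat _
        exact h1.trans (by exact_mod_cast h2)
      exact_mod_cast this)
    (by
      intro v _
      simp only [Finset.coe_Ico, Set.mem_Ico]
      exact ⟨Int.emod_nonneg _ hq'.ne', Int.emod_lt_of_pos _ hq'⟩)
  simp only [Fintype.mem_piFinset, Finset.mem_Ico] at hv hw
  obtain ⟨m, hm⟩ := Int.ModEq.dvd (show (∑ i, v i * p i) ≡ (∑ i, w i * p i) [ZMOD q] from he)
  refine ⟨m, v - w, sub_ne_zero.2 hne, fun i => ?_, ?_⟩
  · have h1 : (v i : ℝ) < A i := Int.lt_ceil.1 (hv i).2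
    have h2 : (w i : ℝ) < A i := Int.lt_ceil.1 (hw i).2
    have h3 : (0 : ℝ) ≤ v i := by exact_mod_cast (hv i).1
    have h4 : (0 : ℝ) ≤ w i := by exact_mod_cast (hw i).1
    rw [abs_lt]; push_cast [Pi.sub_apply]; constructor <;> linarith
  · simp only [Pi.sub_apply, sub_mul, Finset.sum_sub_distrib]
    linarith

theorem pigeon_two {n : ℕ} (y : Fin n → ℝ) (k : Fin n) (a0 : ℤ) (a : Fin n → ℤ)
    (hk : a k ≠ 0) (D : Fin n → ℕ) (hDk : D k = (a k).natAbs) (hD : ∀ i, 1 ≤ D i)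
    (N : ℕ) (hN : ∏ i, D i ≤ N) :
    ∃ q : ℕ, 1 ≤ q ∧ q ≤ N ∧ ∃ p : Fin n → ℤ,
      (∀ i, i ≠ k → |(q : ℝ) * y i - p i| < 1 / D i) ∧ a0 * q + ∑ i, a i * p i = 0 := by
  classical
  let S : ℕ → ℤ := fun q => a0 * q + ∑ j ∈ Finset.univ.erase k, a j * ⌊(q : ℝ) * y j⌋
  let f : ℕ → Fin n → ℤ := fun q i =>
    if i = k then S q % a k else ⌊(D i : ℝ) * Int.fract ((q : ℝ) * y i)⌋
  have key : ∃ q1 ∈ Finset.range (N + 1), ∃ q2 ∈ Finset.range (N + 1), q1 ≠ q2 ∧ f q1 = f q2 := by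
    refine Finset.exists_ne_map_eq_of_card_lt_of_maps_to
      (t := Fintype.piFinset fun i => Finset.Ico (0 : ℤ) (D i)) ?_ ?_
    · rw [Fintype.card_piFinset]
      simp only [Int.card_Ico, sub_zero, Int.toNat_natCast, Finset.card_range]
      omega
    · intro q _
      simp only [Finset.mem_coe, Fintype.mem_piFinset, Finset.mem_Ico]
      intro i
      by_cases hi : i = k
      · subst hi
        simp only [f, if_true, hDk]
        refine ⟨Int.emod_nonneg _ hk, ?_⟩
        rw [Int.natCast_natAbs]
        exact Int.emod_lt_abs _ hk
      · simp only [f, if_neg hi]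
        have hDi : (0 : ℝ) < D i := by exact_mod_cast hD i
        refine ⟨Int.floor_nonneg.2 (mul_nonneg hDi.le (Int.fract_nonneg _)), ?_⟩
        rw [Int.floor_lt]
        have := mul_lt_mul_of_pos_left (Int.fract_lt_one ((q : ℝ) * y i)) hDi
        simpa using this
  have key2 : ∃ q1 q2 : ℕ, q1 < q2 ∧ q2 ≤ N ∧ f q1 = f q2 := by
    obtain ⟨q1, h1, q2, h2, hne, he⟩ := key
    simp only [Finset.mem_range] at h1 h2
    rcases lt_or_gt_of_ne hne with h | h
    · exact ⟨q1, q2, h, by omega, he⟩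
    · exact ⟨q2, q1, h, by omega, he.symm⟩
  obtain ⟨q1, q2, hlt, hle, he⟩ := key2
  have hmod : S q1 % a k = S q2 % a k := by simpa [f] using congrFun he k
  obtain ⟨m, hm⟩ := Int.ModEq.dvd (show S q1 ≡ S q2 [ZMOD a k] from hmod)
  refine ⟨q2 - q1, by omega, by omega,
    fun i => if i = k then -m else ⌊(q2 : ℝ) * y i⌋ - ⌊(q1 : ℝ) * y i⌋, ?_, ?_⟩
  · intro i hi
    have h1 := congrFun he i
    simp only [f, if_neg hi] at h1
    have hDi : (0 : ℝ) < D i := by exact_mod_cast hD i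
    have h2 := Int.abs_sub_lt_one_of_floor_eq_floor h1
    rw [← mul_sub, abs_mul, abs_of_pos hDi] at h2
    simp only [if_neg hi]
    rw [lt_div_iff₀' hDi]
    push_cast [Nat.cast_sub hlt.le]
    have h3 : (q2 : ℝ) * y i - ⌊(q2 : ℝ) * y i⌋ = Int.fract ((q2 : ℝ) * y i) := rfl
    have h4 : (q1 : ℝ) * y i - ⌊(q1 : ℝ) * y i⌋ = Int.fract ((q1 : ℝ) * y i) := rfl
    rw [← h3, ← h4, abs_sub_comm] at h2
    refine lt_of_eq_of_lt ?_ h2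
    congr 2
    ring
  · rw [← Finset.add_sum_erase _ _ (Finset.mem_univ k)]
    rw [Finset.sum_congr rfl (g := fun i => a i * ⌊(q2 : ℝ) * y i⌋ - a i * ⌊(q1 : ℝ) * y i⌋)
      (fun i hi => by simp only [if_neg (Finset.ne_of_mem_erase hi), mul_sub])]
    rw [Finset.sum_sub_distrib]
    simp only [S] at hm
    push_cast [Nat.cast_sub hlt.le]
    rw [if_pos rfl]
    linarith

theorem mulVec_zero {n : ℕ} (y r : Fin n → ℝ) (κ b s : ℝ) (x : Fin (n + 1) → ℝ) :
    (gmat r b s * Gmat κ y).mulVec x 0 = b ^ s * (κ⁻¹ * (x 0 + ∑ i : Fin n, x i.succ * y i)) := by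
  rw [← Matrix.mulVec_mulVec, gmat, Matrix.mulVec_diagonal]
  simp only [Fin.cases_zero, Matrix.mulVec, dotProduct, Gmat, Matrix.of_apply]
  rw [Fin.sum_univ_succ]
  simp only [Fin.cases_zero, Fin.cases_succ]
  rw [mul_add κ⁻¹, Finset.mul_sum]
  congr 2
  exact Finset.sum_congr rfl fun i _ => by ring

theorem mulVec_succ {n : ℕ} (y r : Fin n → ℝ) (κ b s : ℝ) (x : Fin (n + 1) → ℝ) (i : Fin n) :
    (gmat r b s * Gmat κ y).mulVec x i.succ = b ^ (-(r i) * s) * x i.succ := by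
  rw [← Matrix.mulVec_mulVec, gmat, Matrix.mulVec_diagonal]
  simp [Matrix.mulVec, dotProduct, Gmat, Matrix.of_apply]

theorem latDelta_iff {n : ℕ} (y r : Fin n → ℝ) (κ b s : ℝ) (hκ : 0 < κ) (hb : 0 < b) :
    1 ≤ latDelta (latImage (gmat r b s * Gmat κ y) (intLattice (n + 1))) ↔
    ∀ (a0 : ℤ) (a : Fin n → ℤ), (a0 ≠ 0 ∨ a ≠ 0) →
      κ ≤ b ^ s * |(a0 : ℝ) + ∑ i, a i * y i| ∨ ∃ i, b ^ (r i * s) ≤ |(a i : ℝ)| := by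
  have hbs : 0 < b ^ s := Real.rpow_pos_of_pos hb _
  have hbi : ∀ i, 0 < b ^ (r i * s) := fun i => Real.rpow_pos_of_pos hb _
  have hz : ∀ u : ℝ, 1 ≤ ‖b ^ s * (κ⁻¹ * u)‖ ↔ κ ≤ b ^ s * |u| := by
    intro u
    rw [Real.norm_eq_abs, abs_mul, abs_mul, abs_of_pos hbs, abs_of_pos (inv_pos.2 hκ),
      mul_left_comm, ← div_eq_inv_mul, le_div_iff₀ hκ, one_mul]
  have hs : ∀ i (u : ℝ), 1 ≤ ‖b ^ (-(r i) * s) * u‖ ↔ b ^ (r i * s) ≤ |u| := by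
    intro i u
    rw [Real.norm_eq_abs, abs_mul, neg_mul, Real.rpow_neg hb.le, abs_of_pos (inv_pos.2 (hbi i)),
      ← div_eq_inv_mul, le_div_iff₀ (hbi i), one_mul]
  have hnorm : ∀ v : Fin (n + 1) → ℝ, 1 ≤ ‖v‖ ↔ ∃ i, 1 ≤ ‖v i‖ := by
    intro v
    constructor
    · intro h
      by_contra! hc
      exact absurd h (not_le.2 ((pi_norm_lt_iff one_pos).2 hc))
    · rintro ⟨i, hi⟩
      exact hi.trans (norm_le_pi_norm v i)
  have hcoe : ∀ v : Fin (n + 1) → ℝ, (1 : ℝ≥0∞) ≤ (‖v‖₊ : ℝ≥0∞) ↔ 1 ≤ ‖v‖ := by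
    intro v
    rw [← ENNReal.coe_one, ENNReal.coe_le_coe, ← NNReal.coe_le_coe]; simp
  unfold latDelta
  simp only [le_iInf_iff, hcoe, hnorm]
  constructor
  · intro h a0 a hne
    let x : Fin (n + 1) → ℝ := Fin.cons (a0 : ℝ) (fun i => (a i : ℝ))
    have := h ((gmat r b s * Gmat κ y).mulVec x) ⟨⟨x, ?_, rfl⟩, ?_⟩
    · obtain ⟨i, hi⟩ := this
      induction i using Fin.cases with
      | zero => left; rw [mulVec_zero, hz] at hi; simpa [x] using hi
      | succ i => right; rw [mulVec_succ, hs] at hi; exact ⟨i, by simpa [x] using hi⟩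
    · intro i
      induction i using Fin.cases with
      | zero => exact ⟨a0, by simp [x]⟩
      | succ i => exact ⟨a i, by simp [x]⟩
    · rw [Set.mem_singleton_iff]
      intro h0
      have ha : a = 0 := by
        funext i
        have := congrFun h0 i.succ
        rw [mulVec_succ] at this
        simpa [x, (Real.rpow_pos_of_pos hb _).ne'] using this
      have h00 := congrFun h0 0
      rw [mulVec_zero] at h00
      have : a0 = 0 := by simpa [x, ha, hbs.ne', hκ.ne'] using h00
      rcases hne with h | h <;> contradiction
  · rintro h _ ⟨⟨x, hx, rfl⟩, h0⟩
    choose m hm using hx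
    have hne : m 0 ≠ 0 ∨ (fun i : Fin n => m i.succ) ≠ 0 := by
      by_contra! hc
      apply h0
      have : x = 0 := by
        funext i
        rw [hm]
        induction i using Fin.cases with
        | zero => simp [hc.1]
        | succ i => simpa using congrFun hc.2 i
      simp [this]
    rcases h (m 0) (fun i => m i.succ) hne with h | ⟨i, h⟩
    · refine ⟨0, ?_⟩
      simp only
      rw [mulVec_zero, hz]
      simpa [hm] using h
    · refine ⟨i.succ, ?_⟩
      simp only
      rw [mulVec_succ, hs]
      simpa [hm] using h

/-- A small positive `c` with `K * (L * c) ^ r i < ε` for all `i` with `r i > 0`. -/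
theorem exists_small {n : ℕ} (r : Fin n → ℝ) (hr : ∀ i, 0 ≤ r i) (K L ε : ℝ)
    (hε : 0 < ε) :
    ∃ c : ℝ, 0 < c ∧ c < 1 ∧ ∀ i, r i ≠ 0 → K * (L * c) ^ r i < ε := by
  have h1 : ∀ i, ∀ᶠ c in nhdsWithin (0 : ℝ) (Set.Ioi 0), r i ≠ 0 → K * (L * c) ^ r i < ε := by
    intro i
    by_cases h : r i = 0
    · simp [h]
    · have hpos : 0 < r i := lt_of_le_of_ne (hr i) (Ne.symm h)
      have hc : Continuous fun c : ℝ => K * (L * c) ^ r i :=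
        continuous_const.mul ((continuous_const.mul continuous_id).rpow_const
          fun _ => Or.inr hpos.le)
      have ht := hc.tendsto 0
      simp only [mul_zero, Real.zero_rpow h] at ht
      filter_upwards [(ht.eventually (gt_mem_nhds hε)).filter_mono nhdsWithin_le_nhds] with c hc _
      exact hc
  have h2 : ∀ᶠ c in nhdsWithin (0 : ℝ) (Set.Ioi 0), c < 1 :=
    (gt_mem_nhds one_pos : ∀ᶠ c in nhds (0 : ℝ), c < 1).filter_mono nhdsWithin_le_nhds
  obtain ⟨c, hc⟩ := ((Filter.eventually_all.2 h1).and (h2.and self_mem_nhdsWithin)).exists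
  exact ⟨c, hc.2.2, hc.2.1, hc.1⟩

theorem dual_to_bad {n : ℕ} (y r : Fin n → ℝ) (hr : r ∈ Weights n) (κ b : ℝ) (hκ : 0 < κ)
    (hb : 1 < b)
    (h : ∀ t : ℕ, 1 ≤ t → ∀ (a0 : ℤ) (a : Fin n → ℤ), (a0 ≠ 0 ∨ a ≠ 0) →
      κ ≤ b ^ (t : ℝ) * |(a0 : ℝ) + ∑ i, a i * y i| ∨ ∃ i, b ^ (r i * t) ≤ |(a i : ℝ)|) :
    y ∈ BadSet r := by
  obtain ⟨hsum, hnn⟩ := hr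
  have hb0 : 0 < b := by linarith
  obtain ⟨c, hc0, hc1, hc⟩ := exists_small r hnn ((n + 1) * b) b κ hκ
  refine ⟨c, hc0, fun q hq => ?_⟩
  by_contra! hcon
  have hq0 : (0 : ℝ) < q := by exact_mod_cast hq
  obtain ⟨s, hs1, hs2⟩ := exists_nat_pow_near (x := (q : ℝ)) (y := b) (by exact_mod_cast hq) hb
  set t := s + 1 with ht
  have hBr : b ^ (t : ℝ) = b ^ t := Real.rpow_natCast b t
  have hBle : b ^ t ≤ b * q := by
    rw [ht, pow_succ, mul_comm]; exact mul_le_mul_of_nonneg_left hs1 hb0.le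
  have hBpos : 0 < b ^ t := pow_pos hb0 t
  have hpow : ∀ i, b ^ (r i * t) = (b ^ t) ^ r i := fun i => by
    rw [mul_comm, Real.rpow_mul hb0.le, hBr]
  obtain ⟨a0, a, ha, hab, hlin⟩ := pigeon_one q hq (fun i => round ((q : ℝ) * y i))
    (fun i => b ^ (r i * t)) (fun i => Real.rpow_pos_of_pos hb0 _) (by
      simp only [hpow]
      rw [← Real.rpow_sum_of_pos hBpos, hsum, Real.rpow_one]; exact hs2)
  rcases h t (by omega) a0 a (Or.inr ha) with h1 | ⟨i, hi⟩
  swap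
  · exact absurd (hab i) (not_lt.2 hi)
  have hlin' : (a0 : ℝ) * q + ∑ i, (a i : ℝ) * (round ((q : ℝ) * y i) : ℝ) = 0 := by
    exact_mod_cast hlin
  have hw : (q : ℝ) * (a0 + ∑ i, a i * y i) =
      ∑ i, (a i : ℝ) * (q * y i - round ((q : ℝ) * y i)) := by
    simp only [mul_sub, Finset.sum_sub_distrib]
    rw [mul_add, Finset.mul_sum]
    have : ∑ i, (a i : ℝ) * (q * y i) = ∑ i, (q : ℝ) * (a i * y i) :=
      Finset.sum_congr rfl fun i _ => by ring
    linarith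
  have hterm : ∀ i, |(a i : ℝ) * (q * y i - round ((q : ℝ) * y i))| * ((n + 1) * b) ≤ κ := by
    intro i
    have hai := hab i
    by_cases hri : r i = 0
    · rw [hri, zero_mul, Real.rpow_zero] at hai
      have : a i = 0 := Int.abs_lt_one_iff.1 (by exact_mod_cast hai)
      simp [this, hκ.le]
    · have hrp : 0 < r i := lt_of_le_of_ne (hnn i) (Ne.symm hri)
      have h2 := hcon i
      rw [badPow, if_neg hri] at h2
      have h3 : distNearestInt (q * y i) ≤ (c * (q : ℝ)⁻¹) ^ r i := by
        have := Real.rpow_le_rpow (Real.rpow_nonneg (dni_nonneg _) _) h2.le hrp.le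
        rwa [← Real.rpow_mul (dni_nonneg _), one_div_mul_cancel hri, Real.rpow_one] at this
      have h4 := (dni_round _).trans h3
      have h5 : |(a i : ℝ) * (q * y i - round ((q : ℝ) * y i))| ≤ (b * c) ^ r i := by
        rw [abs_mul]
        calc _ ≤ (b * q) ^ r i * (c * (q : ℝ)⁻¹) ^ r i := by
              refine mul_le_mul (hai.le.trans ?_) h4 (abs_nonneg _) (by positivity)
              simp only [hpow]
              exact Real.rpow_le_rpow hBpos.le hBle hrp.le
          _ = _ := by
              rw [← Real.mul_rpow (by positivity) (by positivity)]
              congr 1; field_simp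
      calc _ ≤ (b * c) ^ r i * ((n + 1) * b) := by gcongr
        _ ≤ κ := by rw [mul_comm]; exact (hc i hri).le
  have hS : (q : ℝ) * |(a0 : ℝ) + ∑ i, a i * y i| * ((n + 1) * b) ≤ n * κ := by
    have hqa : (q : ℝ) * |(a0 : ℝ) + ∑ i, a i * y i| =
        |(q : ℝ) * ((a0 : ℝ) + ∑ i, a i * y i)| := by rw [abs_mul, abs_of_pos hq0]
    rw [hqa, hw]
    calc _ ≤ (∑ i, |(a i : ℝ) * (q * y i - round ((q : ℝ) * y i))|) * ((n + 1) * b) := by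
          gcongr; exact Finset.abs_sum_le_sum_abs _ _
      _ = ∑ i, |(a i : ℝ) * (q * y i - round ((q : ℝ) * y i))| * ((n + 1) * b) :=
          Finset.sum_mul _ _ _
      _ ≤ ∑ _i : Fin n, κ := Finset.sum_le_sum fun i _ => hterm i
      _ = n * κ := by simp
  rw [hBr] at h1
  have h6 : κ ≤ b * q * |(a0 : ℝ) + ∑ i, a i * y i| := h1.trans (by gcongr)
  have h7 : (n + 1) * κ ≤ (n + 1) * (b * q * |(a0 : ℝ) + ∑ i, a i * y i|) := by gcongr
  nlinarith

theorem bad_to_dual {n : ℕ} (y r : Fin n → ℝ) (hr : r ∈ Weights n) (hy : y ∈ BadSet r) :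
    ∃ κ : ℝ, 0 < κ ∧ κ < 1 ∧ ∀ B : ℝ, 1 ≤ B → ∀ (a0 : ℤ) (a : Fin n → ℤ), (a0 ≠ 0 ∨ a ≠ 0) →
      κ ≤ B * |(a0 : ℝ) + ∑ i, a i * y i| ∨ ∃ i, B ^ (r i) ≤ |(a i : ℝ)| := by
  obtain ⟨hsum, hnn⟩ := hr
  obtain ⟨c0, hc0, hbad⟩ := hy
  have hr1 : ∀ i, r i ≤ 1 := fun i => hsum ▸
    Finset.single_le_sum (f := r) (fun i _ => hnn i) (Finset.mem_univ i)
  obtain ⟨c, hcp, hc1, hc⟩ := exists_small r hnn (n + 1) c0⁻¹ 1 one_pos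
  obtain ⟨η, hη0, hη1, hη⟩ := exists_small r hnn (2 ^ n) 1 c hcp
  simp only [one_mul] at hη
  refine ⟨η * η, by positivity, by nlinarith, fun B0 hB0 a0 a hne => ?_⟩
  by_contra! hcon
  obtain ⟨hw0, ha0⟩ := hcon
  set w : ℝ := (a0 : ℝ) + ∑ i, a i * y i with hw
  have hzero : ∀ i, r i = 0 → a i = 0 := by
    intro i hi
    have := ha0 i
    rw [hi, Real.rpow_zero] at this
    exact Int.abs_lt_one_iff.1 (by exact_mod_cast this)
  have hane : a ≠ 0 := by
    intro h0
    have hwa : w = a0 := by simp [hw, h0]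
    have : |(a0 : ℝ)| < 1 := by
      rw [hwa] at hw0
      have : |(a0 : ℝ)| ≤ B0 * |(a0 : ℝ)| := le_mul_of_one_le_left (abs_nonneg _) hB0
      nlinarith
    have : a0 = 0 := Int.abs_lt_one_iff.1 (by exact_mod_cast this)
    rcases hne with h | h <;> contradiction
  obtain ⟨i1, hi1⟩ := Function.ne_iff.1 hane
  have hi1 : a i1 ≠ 0 := hi1
  have hri1 : r i1 ≠ 0 := fun h => hi1 (hzero _ h)
  -- the natural size `B` of `a`
  obtain ⟨k0, hk0, hmax0⟩ := Finset.exists_max_image (Finset.univ.filter fun i => r i ≠ 0)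
    (fun i => |(a i : ℝ)| ^ (1 / r i)) ⟨i1, by simpa using hri1⟩
  simp only [Finset.mem_filter, Finset.mem_univ, true_and] at hk0 hmax0
  set B : ℝ := |(a k0 : ℝ)| ^ (1 / r k0) with hB
  have hB1 : 1 ≤ B := by
    refine le_trans ?_ (hmax0 i1 hri1)
    refine Real.one_le_rpow ?_ (one_div_nonneg.2 (hnn _))
    exact_mod_cast Int.one_le_abs hi1
  have hBpos : 0 < B := by linarith
  have haB : ∀ i, |(a i : ℝ)| ≤ B ^ r i := by
    intro i
    by_cases hi : r i = 0
    · simp [hzero i hi, hi]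
    · have := Real.rpow_le_rpow (Real.rpow_nonneg (abs_nonneg _) _) (hmax0 i hi) (hnn i)
      rwa [← Real.rpow_mul (abs_nonneg _), one_div_mul_cancel hi, Real.rpow_one] at this
  have hk0B : |(a k0 : ℝ)| = B ^ r k0 := by
    rw [hB, ← Real.rpow_mul (abs_nonneg _), one_div_mul_cancel hk0, Real.rpow_one]
  have hBB0 : B ≤ B0 := by
    have := Real.rpow_le_rpow (abs_nonneg _) (ha0 k0).le (one_div_nonneg.2 (hnn k0))
    rwa [← Real.rpow_mul (by linarith), mul_one_div_cancel hk0, Real.rpow_one] at this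
  have hwB : B * |w| ≤ η * η := le_trans (by gcongr) hw0.le
  -- the parameter X
  set X : ℝ := B / η with hX
  have hXpos : 0 < X := by positivity
  have hX1 : 1 ≤ X := by rw [hX, le_div_iff₀ hη0]; linarith
  have hBX : B = X * η := by rw [hX]; field_simp
  have hXr : ∀ i, 0 < X ^ r i := fun i => Real.rpow_pos_of_pos hXpos _
  obtain ⟨k, -, hmax⟩ := Finset.exists_max_image (Finset.univ : Finset (Fin n))
    (fun i => |(a i : ℝ)| / X ^ r i) ⟨i1, Finset.mem_univ _⟩
  have hmax : ∀ i, |(a i : ℝ)| / X ^ r i ≤ |(a k : ℝ)| / X ^ r k :=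
    fun i => hmax i (Finset.mem_univ i)
  have hkη : η ≤ |(a k : ℝ)| / X ^ r k := by
    refine le_trans ?_ (hmax k0)
    rw [hk0B, hBX, Real.mul_rpow hXpos.le hη0.le, mul_div_cancel_left₀ _ (hXr k0).ne']
    calc η = η ^ (1 : ℝ) := (Real.rpow_one _).symm
      _ ≤ η ^ r k0 := Real.rpow_le_rpow_of_exponent_ge hη0 hη1.le (hr1 _)
  have hak : a k ≠ 0 := by
    intro h
    rw [h] at hkη
    simp at hkη
    linarith
  have hrk : r k ≠ 0 := fun h => hak (hzero _ h)
  let D : Fin n → ℕ := fun i => if i = k then (a k).natAbs else ⌈X ^ r i⌉₊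
  have hDk : D k = (a k).natAbs := by simp [D]
  have hDi : ∀ i, i ≠ k → D i = ⌈X ^ r i⌉₊ := fun i hi => by simp [D, hi]
  have hD1 : ∀ i, 1 ≤ D i := by
    intro i
    by_cases hi : i = k
    · subst hi; rw [hDk]; exact Int.natAbs_pos.2 hak
    · rw [hDi i hi]; exact Nat.ceil_pos.2 (hXr i)
  have hDbound : ∀ i, (D i : ℝ) ≤ (if i = k then η ^ r k else 1) * (2 * X ^ r i) := by
    intro i
    by_cases hi : i = k
    · subst hi
      rw [hDk, if_pos rfl, Nat.cast_natAbs, Int.cast_abs]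
      refine (haB i).trans ?_
      rw [hBX, Real.mul_rpow hXpos.le hη0.le]
      have : 0 < X ^ r i * η ^ r i := mul_pos (hXr i) (Real.rpow_pos_of_pos hη0 _)
      linarith
    · rw [hDi i hi, if_neg hi]
      have h1 := Nat.ceil_lt_add_one (hXr i).le
      have h2 : 1 ≤ X ^ r i := Real.one_le_rpow hX1 (hnn i)
      linarith
  have hprod : ((∏ i, D i : ℕ) : ℝ) ≤ c * X := by
    push_cast
    calc ∏ i, (D i : ℝ) ≤ ∏ i, (if i = k then η ^ r k else 1) * (2 * X ^ r i) :=
          Finset.prod_le_prod (fun i _ => Nat.cast_nonneg _) fun i _ => hDbound i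
      _ = η ^ r k * (2 ^ n * X) := by
          rw [Finset.prod_mul_distrib, Finset.prod_mul_distrib, ← Real.rpow_sum_of_pos hXpos, hsum,
            Real.rpow_one]
          simp
      _ = (2 ^ n * η ^ r k) * X := by ring
      _ ≤ c * X := by gcongr; exact (hη k hrk).le
  obtain ⟨q, hq1, hqN, p, hp, hlin⟩ := pigeon_two y k a0 a hak D hDk hD1 _ le_rfl
  have hqX : (q : ℝ) ≤ c * X := le_trans (by exact_mod_cast hqN) hprod
  have hq0 : (0 : ℝ) < q := by exact_mod_cast hq1
  have hpi : ∀ i, i ≠ k → |(q : ℝ) * y i - p i| ≤ (X ^ r i)⁻¹ := by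
    intro i hi
    refine (hp i hi).le.trans ?_
    rw [hDi i hi, one_div]
    exact inv_anti₀ (hXr i) (Nat.le_ceil _)
  have hlin' : (a0 : ℝ) * q + ∑ i, (a i : ℝ) * (p i : ℝ) = 0 := by exact_mod_cast hlin
  have hqw : (q : ℝ) * w = ∑ i, (a i : ℝ) * (q * y i - p i) := by
    simp only [mul_sub, Finset.sum_sub_distrib]
    rw [hw, mul_add, Finset.mul_sum]
    have : ∑ i, (a i : ℝ) * (q * y i) = ∑ i, (q : ℝ) * (a i * y i) :=
      Finset.sum_congr rfl fun i _ => by ring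
    linarith
  set m : ℝ := |(a k : ℝ)| / X ^ r k with hm
  have hqw' : |(q : ℝ) * w| ≤ m := by
    refine le_trans ?_ hkη
    rw [abs_mul, abs_of_pos hq0]
    have h1 : (q : ℝ) * |w| ≤ X * |w| := by
      gcongr
      nlinarith
    have h2 : X * |w| ≤ η := by
      have : X * |w| * η ≤ η * η := by rw [hBX] at hwB; linarith
      exact le_of_mul_le_mul_right this hη0
    linarith
  have hkk : |(q : ℝ) * y k - p k| ≤ (n + 1) * (X ^ r k)⁻¹ := by
    have hakp : 0 < |(a k : ℝ)| := by simpa using hak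
    have hm0 : 0 ≤ m := by positivity
    rw [← Finset.add_sum_erase _ _ (Finset.mem_univ k)] at hqw
    have h1 : |(a k : ℝ) * (q * y k - p k)| ≤
        |(q : ℝ) * w| + |∑ i ∈ Finset.univ.erase k, (a i : ℝ) * (q * y i - p i)| := by
      rw [hqw] at *
      have := abs_sub ((a k : ℝ) * (q * y k - p k) +
        ∑ i ∈ Finset.univ.erase k, (a i : ℝ) * (q * y i - p i))
        (∑ i ∈ Finset.univ.erase k, (a i : ℝ) * (q * y i - p i))
      rwa [add_sub_cancel_right] at this
    have h2 : |∑ i ∈ Finset.univ.erase k, (a i : ℝ) * (q * y i - p i)| ≤ n * m := by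
      calc _ ≤ ∑ i ∈ Finset.univ.erase k, |(a i : ℝ) * (q * y i - p i)| :=
            Finset.abs_sum_le_sum_abs _ _
        _ ≤ ∑ i ∈ Finset.univ.erase k, m := by
            refine Finset.sum_le_sum fun i hi => ?_
            rw [abs_mul]
            refine le_trans ?_ (hmax i)
            rw [div_eq_mul_inv]
            exact mul_le_mul_of_nonneg_left (hpi i (Finset.ne_of_mem_erase hi)) (abs_nonneg _)
        _ ≤ ∑ i : Fin n, m :=
            Finset.sum_le_sum_of_subset_of_nonneg (Finset.erase_subset _ _) fun _ _ _ => hm0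
        _ = n * m := by simp
    rw [abs_mul] at h1
    have h3 : |(a k : ℝ)| * |(q : ℝ) * y k - p k| ≤ |(a k : ℝ)| * ((n + 1) * (X ^ r k)⁻¹) := by
      have : |(a k : ℝ)| * ((n + 1) * (X ^ r k)⁻¹) = (n + 1) * m := by
        rw [hm, div_eq_mul_inv]; ring
      rw [this]; linarith
    exact le_of_mul_le_mul_left h3 hakp
  have hall : ∀ i, distNearestInt (q * y i) ≤ (n + 1) * (X ^ r i)⁻¹ := by
    intro i
    refine (dni_le _ (p i)).trans ?_
    by_cases hi : i = k
    · subst hi; exact hkk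
    · refine (hpi i hi).trans ?_
      have : 0 < (X ^ r i)⁻¹ := inv_pos.2 (hXr i)
      have : (0 : ℝ) ≤ n * (X ^ r i)⁻¹ := by positivity
      linarith
  obtain ⟨i, hi⟩ := hbad q hq1
  have hposq : 0 < c0 * (q : ℝ)⁻¹ := by positivity
  by_cases hri : r i = 0
  · rw [badPow, if_pos hri] at hi; linarith
  rw [badPow, if_neg hri] at hi
  have h1 : (c0 * (q : ℝ)⁻¹) ^ r i ≤ distNearestInt (q * y i) := by
    have := Real.rpow_le_rpow hposq.le hi (hnn i)
    rwa [← Real.rpow_mul (dni_nonneg _), one_div_mul_cancel hri, Real.rpow_one] at this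
  have h2 : (c0 * (c * X)⁻¹) ^ r i ≤ (n + 1) * (X ^ r i)⁻¹ := by
    refine le_trans ?_ (h1.trans (hall i))
    refine Real.rpow_le_rpow (by positivity) ?_ (hnn i)
    gcongr
  have h3 := hc i hri
  have h4 : (c0⁻¹ * c) ^ r i * (c0 * (c * X)⁻¹) ^ r i = (X ^ r i)⁻¹ := by
    rw [← Real.mul_rpow (by positivity) (by positivity), ← Real.inv_rpow hXpos.le]
    congr 1; field_simp
  have h5 : 0 < (X ^ r i)⁻¹ := inv_pos.2 (hXr i)
  have h6 : 0 < (c0⁻¹ * c) ^ r i := by positivity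
  have h7 : (X ^ r i)⁻¹ ≤ (c0⁻¹ * c) ^ r i * ((n + 1) * (X ^ r i)⁻¹) := by
    rw [← h4]
    rw [← h4] at h2
    gcongr
  nlinarith

theorem stmt7 (n : ℕ) (y : Fin n → ℝ) (r : Fin n → ℝ) (hr : r ∈ Weights n) :
    y ∈ BadSet r ↔
      ∃ κ : ℝ, 0 < κ ∧ κ < 1 ∧ ∃ b : ℝ, 1 < b ∧ ∀ t : ℕ, 1 ≤ t →
        1 ≤ latDelta (latImage (gmat r b (t : ℝ) * Gmat κ y) (intLattice (n + 1))) := by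
  constructor
  · intro hy
    obtain ⟨κ, h0, h1, h⟩ := bad_to_dual y r hr hy
    refine ⟨κ, h0, h1, 2, one_lt_two, fun t _ => ?_⟩
    rw [latDelta_iff y r κ 2 t h0 two_pos]
    intro a0 a hne
    have := h ((2 : ℝ) ^ (t : ℝ)) (Real.one_le_rpow one_le_two (Nat.cast_nonneg t)) a0 a hne
    simpa only [← Real.rpow_mul (zero_le_two : (0 : ℝ) ≤ 2), mul_comm (t : ℝ)] using this
  · rintro ⟨κ, h0, h1, b, hb, h⟩
    exact dual_to_bad y r hr κ b h0 hb fun t ht =>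
      (latDelta_iff y r κ b t h0 (by linarith)).1 (h t ht)
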